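/- Assume β > s. Then for every constant C₀ > 0 there exist C > 0 and t₀ > 0 such that for all t ∈ (0, t₀) and all v ∈ ℝ with |v t| ≤ C₀ σ_s(t)^{(1+2s)/(2s)}, one has | ∫_0^1 ∫_{B_r^{N-1}} ∫_0^{γ(y')−vt} y_N (∂𝒦_s/∂y_N)((y', θ y_N), σ_s(t)) dy_N dy' dθ | ≤ C σ_s(t), where the innermost integral is the signed integral from 0 to γ(y')−vt. -/

import Mathlib

open MeasureTheory Metric Real Set

noncomputable section

/-- Append a last coordinate: `(y', a) ∈ ℝ^{N-1} × ℝ ↦ ℝ^N`. -/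
def snocPt {d : ℕ} (y' : EuclideanSpace ℝ (Fin d)) (a : ℝ) :
    EuclideanSpace ℝ (Fin (d + 1)) :=
  (EuclideanSpace.equiv (Fin (d + 1)) ℝ).symm
    (Fin.snoc ((EuclideanSpace.equiv (Fin d) ℝ) y') a)

/-- The last standard basis vector `e_N` of `ℝ^N`. -/
def eN (d : ℕ) : EuclideanSpace ℝ (Fin (d + 1)) :=
  EuclideanSpace.single (Fin.last d) 1

/-- `τ_E = 𝟙_E − 𝟙_{ℝ^N ∖ cl E}`. -/
def tauE {d : ℕ} (E : Set (EuclideanSpace ℝ (Fin (d + 1))))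
    (y : EuclideanSpace ℝ (Fin (d + 1))) : ℝ :=
  Set.indicator E (fun _ => 1) y - Set.indicator (closure E)ᶜ (fun _ => 1) y

/-- The kernel `𝒦_s(x,t) = t^{-N/(2s)} P_s(t^{-1/(2s)} x)` with `N = d+1`. -/
def ker {d : ℕ} (s : ℝ) (P : EuclideanSpace ℝ (Fin (d + 1)) → ℝ)
    (x : EuclideanSpace ℝ (Fin (d + 1))) (t : ℝ) : ℝ :=
  t ^ (-(((d : ℝ) + 1) / (2 * s))) * P ((t ^ (-(1 : ℝ) / (2 * s))) • x)

/-- `u(x,t) = ∫_{ℝ^N} 𝒦_s(x−y,t) τ_E(y) dy`. -/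
def uF {d : ℕ} (s : ℝ) (P : EuclideanSpace ℝ (Fin (d + 1)) → ℝ)
    (E : Set (EuclideanSpace ℝ (Fin (d + 1)))) (x : EuclideanSpace ℝ (Fin (d + 1)))
    (t : ℝ) : ℝ :=
  ∫ y, ker s P (x - y) t * tauE E y


/-- The partial derivative `∂𝒦_s/∂y_N` of the kernel in the last coordinate. -/
def kerDN {d : ℕ} (s : ℝ) (P : EuclideanSpace ℝ (Fin (d + 1)) → ℝ)
    (x : EuclideanSpace ℝ (Fin (d + 1))) (t : ℝ) : ℝ :=
  fderiv ℝ (fun z => ker s P z t) x (eN d)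

theorem norm_le_norm_snocPt {d : ℕ} (y' : EuclideanSpace ℝ (Fin d)) (a : ℝ) :
    ‖y'‖ ≤ ‖snocPt y' a‖ := by
  rw [EuclideanSpace.norm_eq, EuclideanSpace.norm_eq]
  apply Real.sqrt_le_sqrt
  rw [Fin.sum_univ_castSucc]
  simp [snocPt]
  positivity

theorem norm_eN (d : ℕ) : ‖eN d‖ = 1 := by
  simp [eN]

theorem kerDN_eq {d : ℕ} (s : ℝ) {P : EuclideanSpace ℝ (Fin (d + 1)) → ℝ}
    (hP : Differentiable ℝ P) (x : EuclideanSpace ℝ (Fin (d + 1))) (t : ℝ) :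
    kerDN s P x t = t ^ (-(((d : ℝ) + 1) / (2 * s))) *
      (t ^ (-(1 : ℝ) / (2 * s)) * fderiv ℝ P ((t ^ (-(1 : ℝ) / (2 * s))) • x) (eN d)) := by
  set c := t ^ (-(1 : ℝ) / (2 * s))
  have h1 : HasFDerivAt (fun z : EuclideanSpace ℝ (Fin (d + 1)) => c • z)
      (c • ContinuousLinearMap.id ℝ _) x := (hasFDerivAt_id x).const_smul c
  have h2 := ((hP (c • x)).hasFDerivAt.comp x h1).const_mul (t ^ (-(((d : ℝ) + 1) / (2 * s))))
  have h3 : fderiv ℝ (fun z => ker s P z t) x = _ := h2.fderiv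
  rw [kerDN, h3]
  simp

/-- The gradient bound on `P`, rescaled to the length `l = t ^ (1 / (2 s))`. -/
theorem abs_kerDN_snocPt_le {d : ℕ} {s : ℝ} (hs : 0 < s)
    {P : EuclideanSpace ℝ (Fin (d + 1)) → ℝ} (hP : Differentiable ℝ P) {K : ℝ} (hK : 0 ≤ K)
    (hPgrad : ∀ y, ‖fderiv ℝ P y‖ ≤ K / (1 + ‖y‖ ^ ((d : ℝ) + 1 + 2 * s + 1)))
    {l : ℝ} (hl : 0 < l) (y' : EuclideanSpace ℝ (Fin d)) (a : ℝ) :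
    |kerDN s P (snocPt y' a) (l ^ (2 * s))| ≤
      K * (l ^ (-((d : ℝ) + 2)) / (1 + (‖y'‖ / l) ^ ((d : ℝ) + 2 + 2 * s))) := by
  have e1 : (l ^ (2 * s)) ^ (-(((d : ℝ) + 1) / (2 * s))) = l ^ (-((d : ℝ) + 1)) := by
    rw [← Real.rpow_mul hl.le]; congr 1; field_simp
  have e2 : (l ^ (2 * s)) ^ (-(1 : ℝ) / (2 * s)) = l⁻¹ := by
    rw [← Real.rpow_mul hl.le, ← Real.rpow_neg_one]; congr 1; field_simp
  have e3 : l ^ (-((d : ℝ) + 2)) = l ^ (-((d : ℝ) + 1)) * l⁻¹ := by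
    rw [← Real.rpow_neg_one, ← Real.rpow_add hl]; congr 1; ring
  rw [kerDN_eq s hP, e1, e2, e3, abs_mul, abs_mul, abs_of_pos (Real.rpow_pos_of_pos hl _),
    abs_of_pos (inv_pos.2 hl)]
  have hn : ‖y'‖ / l ≤ ‖l⁻¹ • snocPt y' a‖ := by
    rw [norm_smul, norm_inv, Real.norm_of_nonneg hl.le, div_eq_inv_mul]
    gcongr
    exact norm_le_norm_snocPt y' a
  have h1 : |fderiv ℝ P (l⁻¹ • snocPt y' a) (eN d)| ≤
      K / (1 + (‖y'‖ / l) ^ ((d : ℝ) + 2 + 2 * s)) := by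
    calc _ ≤ ‖fderiv ℝ P (l⁻¹ • snocPt y' a)‖ * ‖eN d‖ := ContinuousLinearMap.le_opNorm _ _
      _ ≤ K / (1 + ‖l⁻¹ • snocPt y' a‖ ^ ((d : ℝ) + 1 + 2 * s + 1)) := by
        rw [norm_eN, mul_one]; exact hPgrad _
      _ ≤ _ := by
        rw [show (d : ℝ) + 1 + 2 * s + 1 = d + 2 + 2 * s by ring]
        gcongr
  calc _ ≤ l ^ (-((d : ℝ) + 1)) * (l⁻¹ * (K / (1 + (‖y'‖ / l) ^ ((d : ℝ) + 2 + 2 * s)))) := by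
        gcongr
    _ = _ := by ring

theorem inv_one_add_rpow_le {x a b : ℝ} (hx : 0 < x) (hb : 0 ≤ b) (hab : b ≤ a) :
    (1 + x ^ a)⁻¹ ≤ x ^ (-b) := by
  rw [Real.rpow_neg hx.le]
  have hxa := Real.rpow_pos_of_pos hx a
  apply inv_anti₀ (Real.rpow_pos_of_pos hx _)
  rcases le_total x 1 with h | h
  · have := Real.rpow_le_one hx.le h hb
    linarith
  · have := Real.rpow_le_rpow_of_exponent_le h hab
    linarith

theorem integrableOn_norm_rpow_ball {d : ℕ} (hd : 1 ≤ d) {p : ℝ} (hp : -(d : ℝ) < p) (r : ℝ) :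
    IntegrableOn (fun y : EuclideanSpace ℝ (Fin d) => ‖y‖ ^ p) (ball 0 r) := by
  have : Nonempty (Fin d) := ⟨⟨0, hd⟩⟩
  rcases le_or_gt r 0 with hr | hr
  · simp [Metric.ball_eq_empty.2 hr]
  rw [← integrable_indicator_iff measurableSet_ball]
  have e : (ball (0 : EuclideanSpace ℝ (Fin d)) r).indicator (fun y => ‖y‖ ^ p) =
      fun y => (Iio r).indicator (fun x : ℝ => x ^ p) ‖y‖ := by
    ext y
    simp [indicator]
  rw [e, integrable_fun_norm_addHaar volume]
  have hI : IntegrableOn (fun x : ℝ => x ^ ((d : ℝ) - 1 + p)) (Ioo 0 r) :=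
    (intervalIntegral.integrableOn_Ioo_rpow_iff hr).2 (by linarith)
  rw [← integrable_indicator_iff measurableSet_Ioo] at hI
  rw [← integrable_indicator_iff measurableSet_Ioi]
  convert hI using 1
  ext x
  by_cases h0 : 0 < x
  · by_cases h1 : x < r
    · simp only [indicator, mem_Ioi, h0, mem_Iio, h1, mem_Ioo, if_true, and_self, smul_eq_mul]
      rw [Real.rpow_add h0, finrank_euclideanSpace_fin]
      congr 1
      rw [← Real.rpow_natCast, Nat.cast_sub hd, Nat.cast_one]
    · simp [indicator, h0, h1]
  · simp [indicator, h0]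

/-- A function whose derivative is `β`-Hölder and which vanishes to first order at the origin is
of size `‖y‖ ^ (1 + β)`. -/
theorem abs_le_of_holder_fderivWithin {E : Type*} [NormedAddCommGroup E] [NormedSpace ℝ E]
    {r β L : ℝ} (hβ : 0 < β) {γ : E → ℝ} (hγdiff : DifferentiableOn ℝ γ (ball 0 r))
    (hγhold : ∀ x ∈ ball (0 : E) r, ‖fderivWithin ℝ γ (ball 0 r) x‖ ≤ L * ‖x‖ ^ β)
    (hγ0 : γ 0 = 0) {y : E} (hy : y ∈ ball 0 r) :
    |γ y| ≤ |L| * ‖y‖ ^ (1 + β) := by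
  have hsub : closedBall (0 : E) ‖y‖ ⊆ ball 0 r :=
    closedBall_subset_ball (by simpa using hy)
  have h := (convex_closedBall (0 : E) ‖y‖).norm_image_sub_le_of_norm_hasFDerivWithin_le
    (f := γ) (f' := fderivWithin ℝ γ (ball 0 r)) (C := |L| * ‖y‖ ^ β)
    (fun x hx => ((hγdiff x (hsub hx)).hasFDerivWithinAt).mono hsub)
    (fun x hx => by
      refine (hγhold x (hsub hx)).trans ?_
      have : ‖x‖ ≤ ‖y‖ := by simpa using hx
      gcongr
      exact le_abs_self L)
    (x := 0) (y := y) (by simp) (by simp)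
  rw [hγ0, sub_zero, sub_zero, Real.norm_eq_abs] at h
  refine h.trans (le_of_eq ?_)
  rcases eq_or_ne y 0 with rfl | h0
  · simp [Real.zero_rpow (by linarith : (1 + β) ≠ 0)]
  · rw [Real.rpow_add (norm_pos_iff.2 h0), Real.rpow_one]
    ring

theorem abs_intervalIntegral_id_mul_le {f : ℝ → ℝ} {M : ℝ} (hf : ∀ y, |f y| ≤ M) (b : ℝ) :
    |∫ y in (0 : ℝ)..b, y * f y| ≤ b ^ 2 * M := by
  have h := intervalIntegral.norm_integral_le_of_norm_le_const (a := 0) (b := b)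
    (f := fun y => y * f y) (C := |b| * M) (fun y hy => by
      rw [norm_mul, Real.norm_eq_abs, Real.norm_eq_abs]
      have : |y| ≤ |b| := by
        rw [mem_uIoc] at hy
        rcases hy with ⟨h1, h2⟩ | ⟨h1, h2⟩
        · exact abs_le_abs h2 (by linarith)
        · rw [abs_of_nonpos h2, abs_of_nonpos (by linarith)]; linarith
      exact mul_le_mul this (hf y) (abs_nonneg _) (abs_nonneg _))
  rw [Real.norm_eq_abs, sub_zero] at h
  calc _ ≤ _ := h
    _ = |b| ^ 2 * M := by ring
    _ = _ := by rw [sq_abs]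

theorem rescaled_kernel_weight_le {d s β A B l x b : ℝ} (hd : 1 ≤ d) (hs : s ∈ Ioo (0 : ℝ) 1)
    (hl : 0 < l) (hl1 : l ≤ 1) (hx : 0 < x)
    (hb : |b| ≤ A * x ^ (1 + β) + B * l ^ (1 + 2 * s)) :
    b ^ 2 * (l ^ (-(d + 2)) / (1 + (x / l) ^ (d + 2 + 2 * s))) ≤
      (2 * A ^ 2 * x ^ (2 * (β - s) - d) + 2 * B ^ 2 * x ^ (s - d)) * l ^ (2 * s) := by
  obtain ⟨hs0, hs1⟩ := hs
  have hxl : 0 < x / l := div_pos hx hl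
  set w := (1 + (x / l) ^ (d + 2 + 2 * s))⁻¹ with hw
  have hw0 : 0 ≤ w := by positivity
  have hlp : 0 < l ^ (-(d + 2)) := Real.rpow_pos_of_pos hl _
  have hb2 : b ^ 2 ≤ 2 * A ^ 2 * (x ^ (1 + β)) ^ 2 + 2 * B ^ 2 * (l ^ (1 + 2 * s)) ^ 2 := by
    have h1 : b ^ 2 ≤ (A * x ^ (1 + β) + B * l ^ (1 + 2 * s)) ^ 2 :=
      sq_le_sq' (by linarith [neg_abs_le b]) (by linarith [le_abs_self b])
    nlinarith [sq_nonneg (A * x ^ (1 + β) - B * l ^ (1 + 2 * s))]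
  have key1 : (x ^ (1 + β)) ^ 2 * (l ^ (-(d + 2)) * w) ≤ x ^ (2 * (β - s) - d) * l ^ (2 * s) := by
    calc _ ≤ (x ^ (1 + β)) ^ 2 * (l ^ (-(d + 2)) * (x / l) ^ (-(d + 2 + 2 * s))) := by
          gcongr
          exact inv_one_add_rpow_le hxl (by linarith) le_rfl
      _ = _ := by
          rw [Real.div_rpow hx.le hl.le, ← Real.rpow_natCast, ← Real.rpow_mul hx.le, div_eq_mul_inv,
            ← Real.rpow_neg hl.le, mul_left_comm (l ^ _), ← mul_assoc, ← Real.rpow_add hx,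
            ← Real.rpow_add hl]
          push_cast
          ring_nf
  have key2 : (l ^ (1 + 2 * s)) ^ 2 * (l ^ (-(d + 2)) * w) ≤ x ^ (s - d) * l ^ (2 * s) := by
    calc _ ≤ (l ^ (1 + 2 * s)) ^ 2 * (l ^ (-(d + 2)) * (x / l) ^ (-(d - s))) := by
          gcongr
          exact inv_one_add_rpow_le hxl (by linarith) (by linarith)
      _ = x ^ (s - d) * l ^ (3 * s) := by
          rw [Real.div_rpow hx.le hl.le, ← Real.rpow_natCast, ← Real.rpow_mul hl.le, div_eq_mul_inv,
            ← Real.rpow_neg hl.le, mul_left_comm (l ^ (-(d + 2))), mul_left_comm,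
            ← Real.rpow_add hl, ← Real.rpow_add hl]
          push_cast
          ring_nf
      _ ≤ _ := by
          gcongr ?_ * ?_
          exact Real.rpow_le_rpow_of_exponent_ge hl hl1 (by linarith)
  rw [div_eq_mul_inv, ← hw]
  calc _ ≤ (2 * A ^ 2 * (x ^ (1 + β)) ^ 2 + 2 * B ^ 2 * (l ^ (1 + 2 * s)) ^ 2) *
          (l ^ (-(d + 2)) * w) := by gcongr
    _ = 2 * A ^ 2 * ((x ^ (1 + β)) ^ 2 * (l ^ (-(d + 2)) * w)) +
          2 * B ^ 2 * ((l ^ (1 + 2 * s)) ^ 2 * (l ^ (-(d + 2)) * w)) := by ring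
    _ ≤ 2 * A ^ 2 * (x ^ (2 * (β - s) - d) * l ^ (2 * s)) +
          2 * B ^ 2 * (x ^ (s - d) * l ^ (2 * s)) := by gcongr
    _ = _ := by ring

/-- Lemma on the error term: if `β > s` then for `|v t| ≤ C₀ σ_s(t)^{(1+2s)/(2s)}`
the triple integral `∫_0^1 ∫_{B_r^{N-1}} ∫_0^{γ(y')−vt} y_N ∂_N𝒦_s((y',θ y_N),σ_s(t)) dy_N dy' dθ`
is `O(σ_s(t))`. -/
theorem stmt6
    (d : ℕ) (hd : 1 ≤ d) (s : ℝ) (hs : s ∈ Set.Ioo (0 : ℝ) 1)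
    (P : EuclideanSpace ℝ (Fin (d + 1)) → ℝ)
    (hPrad : ∀ x y, ‖x‖ = ‖y‖ → P x = P y)
    (hP1 : ContDiff ℝ 1 P)
    (𝒞 : ℝ) (h𝒞 : 1 ≤ 𝒞)
    (hPlow : ∀ y, 𝒞⁻¹ / (1 + ‖y‖ ^ ((d : ℝ) + 1 + 2 * s)) ≤ P y)
    (hPup : ∀ y, P y ≤ 𝒞 / (1 + ‖y‖ ^ ((d : ℝ) + 1 + 2 * s)))
    (hPgrad : ∀ y, ‖fderiv ℝ P y‖ ≤ 𝒞 / (1 + ‖y‖ ^ ((d : ℝ) + 1 + 2 * s + 1)))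
    (r β : ℝ) (hr : 0 < r) (hβ : β ∈ Set.Ioc (0 : ℝ) 1)
    (γ : EuclideanSpace ℝ (Fin d) → ℝ)
    (hγdiff : ContDiffOn ℝ 1 γ (ball 0 r))
    (L : ℝ)
    (hγhold : ∀ x ∈ ball (0 : EuclideanSpace ℝ (Fin d)) r,
      ∀ y ∈ ball (0 : EuclideanSpace ℝ (Fin d)) r,
      ‖fderivWithin ℝ γ (ball 0 r) x - fderivWithin ℝ γ (ball 0 r) y‖ ≤ L * ‖x - y‖ ^ β)
    (hγ0 : γ 0 = 0)
    (hdγ0 : fderivWithin ℝ γ (ball 0 r) 0 = 0)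
    (hβs : s < β)
    (σ : ℝ → ℝ)
    (hσlt : s < 1 / 2 → ∀ t > (0 : ℝ), σ t = t ^ (2 * s / (1 + 2 * s)))
    (hσgt : 1 / 2 < s → ∀ t > (0 : ℝ), σ t = t ^ s)
    (hσeq : s = 1 / 2 → ∀ t ∈ Set.Ioo (0 : ℝ) (1 / (2 * Real.exp 1)),
      σ t ∈ Set.Ioo 0 (Real.exp (-(1 / 2))) ∧ (σ t) ^ 2 * Real.log (1 / σ t) = t) :
    ∀ C₀ > (0 : ℝ), ∃ C > (0 : ℝ), ∃ t₀ > (0 : ℝ), ∀ t ∈ Set.Ioo (0 : ℝ) t₀, ∀ v : ℝ,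
      |v * t| ≤ C₀ * (σ t) ^ ((1 + 2 * s) / (2 * s)) →
      |∫ θ in (0 : ℝ)..1, ∫ y' in ball (0 : EuclideanSpace ℝ (Fin d)) r,
          ∫ yN in (0 : ℝ)..(γ y' - v * t),
            yN * kerDN s P (snocPt y' (θ * yN)) (σ t)| ≤ C * σ t := by
  intro C₀ hC₀
  have hs0 : 0 < s := hs.1
  have hd1 : (1 : ℝ) ≤ d := by exact_mod_cast hd
  have hσ01 : ∃ t₀ > (0 : ℝ), ∀ t ∈ Ioo (0 : ℝ) t₀, 0 < σ t ∧ σ t ≤ 1 := by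
    rcases lt_trichotomy s (1 / 2) with h | h | h
    · refine ⟨1, one_pos, fun t ht => ?_⟩
      rw [hσlt h t ht.1]
      exact ⟨Real.rpow_pos_of_pos ht.1 _, Real.rpow_le_one ht.1.le ht.2.le (by positivity)⟩
    · refine ⟨1 / (2 * Real.exp 1), by positivity, fun t ht => ?_⟩
      have h2 := (hσeq h t ht).1
      exact ⟨h2.1, h2.2.le.trans (Real.exp_le_one_iff.2 (by norm_num))⟩
    · refine ⟨1, one_pos, fun t ht => ?_⟩
      rw [hσgt h t ht.1]
      exact ⟨Real.rpow_pos_of_pos ht.1 _, Real.rpow_le_one ht.1.le ht.2.le hs0.le⟩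
  obtain ⟨t₀, ht₀, hσ01⟩ := hσ01
  set G : EuclideanSpace ℝ (Fin d) → ℝ := fun y =>
    𝒞 * (2 * |L| ^ 2 * ‖y‖ ^ (2 * (β - s) - d) + 2 * C₀ ^ 2 * ‖y‖ ^ (s - d)) with hG
  have hGint : IntegrableOn G (ball 0 r) :=
    (((integrableOn_norm_rpow_ball hd (by linarith) r).const_mul _).add
      ((integrableOn_norm_rpow_ball hd (by linarith) r).const_mul _)).const_mul _
  have hG0 : 0 ≤ ∫ y in ball 0 r, G y := by
    apply integral_nonneg
    intro y
    simp only [hG, Pi.zero_apply]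
    positivity
  refine ⟨(∫ y in ball 0 r, G y) + 1, by positivity, t₀, ht₀, fun t ht v hv => ?_⟩
  obtain ⟨hσ0, hσ1⟩ := hσ01 t ht
  obtain ⟨l, hl, hl1, hlσ⟩ : ∃ l : ℝ, 0 < l ∧ l ≤ 1 ∧ σ t = l ^ (2 * s) :=
    ⟨σ t ^ (2 * s)⁻¹, Real.rpow_pos_of_pos hσ0 _, Real.rpow_le_one hσ0.le hσ1 (by positivity),
      (Real.rpow_inv_rpow hσ0.le (by positivity)).symm⟩
  rw [hlσ] at hv ⊢
  have hv' : |v * t| ≤ C₀ * l ^ (1 + 2 * s) := by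
    rw [← Real.rpow_mul hl.le] at hv
    convert hv using 3
    field_simp
  have : Nonempty (Fin d) := ⟨⟨0, hd⟩⟩
  have hinner : ∀ θ : ℝ, ‖∫ y' in ball (0 : EuclideanSpace ℝ (Fin d)) r,
      ∫ yN in (0 : ℝ)..(γ y' - v * t), yN * kerDN s P (snocPt y' (θ * yN)) (l ^ (2 * s))‖ ≤
      (∫ y in ball 0 r, G y) * l ^ (2 * s) := by
    intro θ
    rw [← integral_mul_const]
    refine norm_integral_le_of_norm_le (hGint.mul_const _) ?_
    have hne : ∀ᵐ y : EuclideanSpace ℝ (Fin d) ∂(volume.restrict (ball 0 r)), y ≠ 0 :=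
      ae_restrict_of_ae (Measure.ae_ne volume 0)
    filter_upwards [ae_restrict_mem measurableSet_ball, hne] with y hy hy0
    have hγy : |γ y| ≤ |L| * ‖y‖ ^ (1 + β) :=
      abs_le_of_holder_fderivWithin hβ.1 (hγdiff.differentiableOn one_ne_zero)
        (fun x hx => by simpa [hdγ0] using hγhold x hx 0 (mem_ball_self hr)) hγ0 hy
    have hb : |γ y - v * t| ≤ |L| * ‖y‖ ^ (1 + β) + C₀ * l ^ (1 + 2 * s) :=
      (abs_sub _ _).trans (add_le_add hγy hv')
    have h1 := abs_intervalIntegral_id_mul_le (fun yN => abs_kerDN_snocPt_le hs0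
      (hP1.differentiable one_ne_zero) (by linarith) hPgrad hl y (θ * yN)) (γ y - v * t)
    have h2 := rescaled_kernel_weight_le hd1 hs hl hl1 (norm_pos_iff.2 hy0) hb
    rw [Real.norm_eq_abs]
    calc _ ≤ _ := h1
      _ = 𝒞 * ((γ y - v * t) ^ 2 *
          (l ^ (-((d : ℝ) + 2)) / (1 + (‖y‖ / l) ^ ((d : ℝ) + 2 + 2 * s)))) := by ring
      _ ≤ _ := mul_le_mul_of_nonneg_left h2 (by linarith)
      _ = _ := by simp only [hG]; ring
  have h := intervalIntegral.norm_integral_le_of_norm_le_const (a := (0 : ℝ)) (b := 1)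
    (fun θ _ => hinner θ)
  rw [Real.norm_eq_abs, sub_zero, abs_one, mul_one] at h
  refine h.trans ?_
  gcongr
  linarith
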